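/- arXiv:1711.03076 — 4 statements merged into one kernel-verified Lean document; each statement's English description precedes it below -/
import Mathlib

section
/- Let G = (V,E) be a graph, H a subgraph of G, and β ≥ 1 an integer. Define the potential Φ(H) := (β − 1/2)·Σ_{u∈V} deg_H(u) − Σ_{(u,v)∈E(H)} (deg_H(u) + deg_H(v)). If e = (u,v) is an edge of H with deg_H(u) + deg_H(v) ≥ β + 1, and H' is obtained from H by deleting e, then Φ(H') ≥ Φ(H) + 1. -/
/-- The degree of vertex `v` in the (sub)graph `H`. -/
noncomputable def deg {V : Type*} (H : SimpleGraph V) (v : V) : ℕ :=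
  (H.neighborSet v).ncard

/-- The potential `Φ(H) = (β - 1/2) · Σ_{u ∈ V} deg_H(u)
      - Σ_{(u,v) ∈ E(H)} (deg_H(u) + deg_H(v))`. -/
noncomputable def Phi {V : Type*} [Fintype V] (β : ℝ) (H : SimpleGraph V) : ℝ :=
  (β - 1 / 2) * ∑ u : V, (deg H u : ℝ) -
    ∑ᶠ e ∈ H.edgeSet,
      Sym2.lift ⟨fun u v => (deg H u : ℝ) + (deg H v : ℝ), fun u v => by ring⟩ e

theorem deg_eq_degree {V : Type*} [Fintype V] (H : SimpleGraph V) [DecidableRel H.Adj] (v : V) :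
    deg H v = H.degree v := by
  rw [deg, Set.ncard_eq_toFinset_card', Set.toFinset_card, H.card_neighborSet_eq_degree]

/-- Summing `f u + f v` over the edges `s(u, v)` counts each `f w` once per edge at `w`. -/
theorem finsum_edgeSet_add {V : Type*} [Fintype V] (H : SimpleGraph V) (f : V → ℝ) :
    ∑ᶠ e ∈ H.edgeSet, Sym2.lift ⟨fun u v => f u + f v, fun u v => add_comm (f u) (f v)⟩ e =
      ∑ w, deg H w * f w := by
  classical
  have hedge : ∀ e ∈ H.edgeFinset,
      Sym2.lift ⟨fun u v => f u + f v, fun u v => add_comm (f u) (f v)⟩ e =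
        ∑ w, if w ∈ e then f w else 0 := by
    intro e he
    induction e with
    | h a b =>
      have hab : a ≠ b := (SimpleGraph.mem_edgeFinset.mp he : H.Adj a b).ne
      rw [Sym2.lift_mk, ← Finset.sum_filter]
      refine (Finset.sum_pair hab).symm.trans ?_
      congr 1
      ext w
      simp
  rw [← H.coe_edgeFinset, finsum_mem_coe_finset, Finset.sum_congr rfl hedge, Finset.sum_comm]
  refine Finset.sum_congr rfl fun w _ => ?_
  rw [← Finset.sum_filter, Finset.sum_const, nsmul_eq_mul, deg_eq_degree,
    ← H.card_incidenceFinset_eq_degree, H.incidenceFinset_eq_filter]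

theorem Phi_eq_sum {V : Type*} [Fintype V] (β : ℝ) (H : SimpleGraph V) :
    Phi β H = ∑ w, ((β - 1 / 2) * deg H w - deg H w * deg H w) := by
  rw [Phi, finsum_edgeSet_add H fun w => (deg H w : ℝ), Finset.sum_sub_distrib, Finset.mul_sum]

theorem deg_deleteEdges_add_one {V : Type*} [Finite V] {H : SimpleGraph V} {u v : V}
    (huv : H.Adj u v) : deg (H.deleteEdges {s(u, v)}) u + 1 = deg H u := by
  have hset : (H.deleteEdges {s(u, v)}).neighborSet u = H.neighborSet u \ {v} := by
    ext w
    simp [huv.ne]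
  rw [deg, hset]
  exact Set.ncard_sdiff_singleton_add_one huv

theorem deg_deleteEdges_of_ne {V : Type*} {H : SimpleGraph V} {u v w : V}
    (hu : w ≠ u) (hv : w ≠ v) : deg (H.deleteEdges {s(u, v)}) w = deg H w := by
  have hset : (H.deleteEdges {s(u, v)}).neighborSet w = H.neighborSet w := by
    ext x
    simp [hu, hv]
  rw [deg, hset, deg]

/-- If `e = (u,v)` is an edge of `H` with `deg_H(u) + deg_H(v) ≥ β + 1`, then deleting `e`
from `H` increases the potential `Φ` by at least `1`. -/
theorem phi_increase_of_delete {V : Type*} [Fintype V] (G H : SimpleGraph V)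
    (hHG : H ≤ G) (β : ℤ) (hβ : 1 ≤ β) (u v : V) (huv : H.Adj u v)
    (hdeg : (β : ℝ) + 1 ≤ (deg H u : ℝ) + (deg H v : ℝ)) :
    Phi (β : ℝ) H + 1 ≤ Phi (β : ℝ) (H.deleteEdges {s(u, v)}) := by
  have hu : (deg (H.deleteEdges {s(u, v)}) u : ℝ) + 1 = deg H u := by
    exact_mod_cast deg_deleteEdges_add_one huv
  have hv : (deg (H.deleteEdges {s(u, v)}) v : ℝ) + 1 = deg H v := by
    rw [Sym2.eq_swap]
    exact_mod_cast deg_deleteEdges_add_one huv.symm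
  rw [← le_sub_iff_add_le', Phi_eq_sum, Phi_eq_sum, ← Finset.sum_sub_distrib,
    Finset.sum_eq_add u v huv.ne
      (fun w _ hw => by rw [deg_deleteEdges_of_ne hw.1 hw.2, sub_self]) (by simp) (by simp)]
  rw [← hu, ← hv] at hdeg ⊢
  linarith
end

section
/- Let G = (V,E) be a graph, let 0 < λ < 1 and β > 0 be reals, and let A and B be subgraphs of G that are each an EDCS(G, β, (1−λ)β). Let D > 0 be a real and let S ⊆ V satisfy deg_A(v) − deg_B(v) ≥ D for all v ∈ S. Define T := {v ∈ V : there exists u ∈ S with (u,v) an edge of A but not of B} and T' := {w ∈ V : there exists v ∈ T with (v,w) an edge of B but not of A}. Then: (i) for all v ∈ T, deg_B(v) − deg_A(v) ≥ D − λβ; and (ii) for all w ∈ T', deg_A(w) − deg_B(w) ≥ D − 2λβ. -/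
/-- `H` is an edge degree constrained subgraph `EDCS(G, β, β⁻)`. -/
def IsEDCS {V : Type*} (G H : SimpleGraph V) (β βm : ℝ) : Prop :=
  H ≤ G ∧
    (∀ u v : V, H.Adj u v → (deg H u : ℝ) + (deg H v : ℝ) ≤ β) ∧
    (∀ u v : V, G.Adj u v → ¬ H.Adj u v → βm ≤ (deg H u : ℝ) + (deg H v : ℝ))

/-- Across an edge of `A` missing from `B`, the degree surplus of `A` over `B` at one endpoint
turns into a surplus of `B` over `A` at the other endpoint, up to a loss of `lam * β`. -/
theorem IsEDCS.degree_gap_of_adj {V : Type*} {G A B : SimpleGraph V} {lam β D : ℝ}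
    (hA : IsEDCS G A β ((1 - lam) * β)) (hB : IsEDCS G B β ((1 - lam) * β)) {u v : V}
    (hu : D ≤ (deg A u : ℝ) - (deg B u : ℝ)) (huv : A.Adj u v) (hnuv : ¬ B.Adj u v) :
    D - lam * β ≤ (deg B v : ℝ) - (deg A v : ℝ) := by
  have hle := hA.2.1 u v huv
  have hge := hB.2.2 u v (hA.1 huv) hnuv
  linarith

/-- Let `A, B` be two `EDCS(G, β, (1-λ)β)` and `S` a set of vertices whose degree in `A`
exceeds their degree in `B` by at least `D > 0`.  Let `T` be the neighbors of `S` along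
edges of `A \ B`, and `T'` the neighbors of `T` along edges of `B \ A`.  Then every
`v ∈ T` has `deg_B(v) - deg_A(v) ≥ D - λβ`, and every `w ∈ T'` has
`deg_A(w) - deg_B(w) ≥ D - 2λβ`. -/
theorem edcs_neighbor_degree_gap {V : Type*} [Fintype V] (G A B : SimpleGraph V)
    (lam β D : ℝ) (hlam0 : 0 < lam) (hlam1 : lam < 1) (hβ : 0 < β)
    (hA : IsEDCS G A β ((1 - lam) * β)) (hB : IsEDCS G B β ((1 - lam) * β))
    (hD : 0 < D) (S : Set V) (hS : ∀ v ∈ S, D ≤ (deg A v : ℝ) - (deg B v : ℝ)) :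
    (∀ v ∈ {v : V | ∃ u ∈ S, A.Adj u v ∧ ¬ B.Adj u v},
        D - lam * β ≤ (deg B v : ℝ) - (deg A v : ℝ)) ∧
    (∀ w ∈ {w : V | ∃ v ∈ {v : V | ∃ u ∈ S, A.Adj u v ∧ ¬ B.Adj u v},
        B.Adj v w ∧ ¬ A.Adj v w},
        D - 2 * lam * β ≤ (deg A w : ℝ) - (deg B w : ℝ)) := by
  have hT : ∀ v ∈ {v : V | ∃ u ∈ S, A.Adj u v ∧ ¬ B.Adj u v},
      D - lam * β ≤ (deg B v : ℝ) - (deg A v : ℝ) := by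
    rintro v ⟨u, hu, huv, hnuv⟩
    exact hA.degree_gap_of_adj hB (hS u hu) huv hnuv
  refine ⟨hT, ?_⟩
  rintro w ⟨v, hv, hvw, hnvw⟩
  have hw := hB.degree_gap_of_adj hA (hT v hv) hvw hnvw
  linarith
end

section
/- Let G = (V,E) be a graph, let 0 < λ < 1/100 and β > 0 be reals, and let A and B be subgraphs of G that are each an EDCS(G, β, (1−λ)β). Fix a real D > 2·λ^{1/2}·β and suppose S ⊆ V is such that deg_A(v) − deg_B(v) ≥ D for all v ∈ S. Then there exists a set of vertices S' ⊇ S such that |S'| ≥ (1 + 2λ^{1/2})·|S| and for all v ∈ S', deg_A(v) − deg_B(v) ≥ D − 2λβ. -/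
open scoped Classical in
/-- The number of neighbours of `v` in `A` that are not neighbours of `v` in `B`. -/
noncomputable def degDiff {V : Type*} [Fintype V] (A B : SimpleGraph V) (v : V) : ℝ :=
  ∑ u, if A.Adj v u ∧ ¬ B.Adj v u then (1 : ℝ) else 0

open scoped Classical in
theorem deg_eq_sum {V : Type*} [Fintype V] (A : SimpleGraph V) (v : V) :
    (deg A v : ℝ) = ∑ u, if A.Adj v u then (1 : ℝ) else 0 := by
  rw [deg, Set.ncard_eq_toFinset_card', Finset.sum_boole]
  congr 2
  ext u
  simp

theorem degDiff_sub_degDiff {V : Type*} [Fintype V] (A B : SimpleGraph V) (v : V) :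
    degDiff A B v - degDiff B A v = (deg A v : ℝ) - deg B v := by
  classical
  rw [deg_eq_sum, deg_eq_sum, degDiff, degDiff, ← Finset.sum_sub_distrib,
    ← Finset.sum_sub_distrib]
  refine Finset.sum_congr rfl fun u _ => ?_
  by_cases h₁ : A.Adj v u <;> by_cases h₂ : B.Adj v u <;> simp [h₁, h₂]

theorem degDiff_le_deg {V : Type*} [Fintype V] (A B : SimpleGraph V) (v : V) :
    degDiff A B v ≤ deg A v := by
  classical
  rw [deg_eq_sum, degDiff]
  refine Finset.sum_le_sum fun u _ => ?_
  by_cases h₁ : A.Adj v u <;> by_cases h₂ : B.Adj v u <;> simp [h₁, h₂]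

/-- If every edge of `A \ B` leaving `S` ends in `T`, then double counting these edges bounds
the total difference degree of `S` by that of `T`. -/
theorem sum_degDiff_le_sum_degDiff {V : Type*} [Fintype V] (A B : SimpleGraph V)
    (S T : Finset V) (h : ∀ v ∈ S, ∀ u, A.Adj v u → ¬ B.Adj v u → u ∈ T) :
    ∑ v ∈ S, degDiff A B v ≤ ∑ u ∈ T, degDiff A B u := by
  classical
  calc ∑ v ∈ S, degDiff A B v
      = ∑ v ∈ S, ∑ u ∈ T, if A.Adj v u ∧ ¬ B.Adj v u then (1 : ℝ) else 0 := by
        refine Finset.sum_congr rfl fun v hv => ?_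
        refine (Finset.sum_subset (Finset.subset_univ T) fun u _ hu => ?_).symm
        exact if_neg fun hvu => hu (h v hv u hvu.1 hvu.2)
    _ = ∑ u ∈ T, ∑ v ∈ S, if A.Adj u v ∧ ¬ B.Adj u v then (1 : ℝ) else 0 := by
        rw [Finset.sum_comm]
        simp only [A.adj_comm, B.adj_comm]
    _ ≤ ∑ u ∈ T, degDiff A B u := by
        refine Finset.sum_le_sum fun u _ => ?_
        refine Finset.sum_le_sum_of_subset_of_nonneg (Finset.subset_univ S) fun v _ _ => ?_
        split_ifs <;> norm_num

theorem IsEDCS.deg_le {V : Type*} {G H : SimpleGraph V} {β βm : ℝ}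
    (h : IsEDCS G H β βm) (hβ : 0 ≤ β) (v : V) : (deg H v : ℝ) ≤ β := by
  rcases (H.neighborSet v).eq_empty_or_nonempty with he | ⟨u, hu⟩
  · simpa [deg, he] using hβ
  · have := h.2.1 v u hu
    have : (0 : ℝ) ≤ deg H u := Nat.cast_nonneg _
    linarith

/-- Along an edge of `A \ B` the degree gap changes sign and shrinks by at most `β - βm`. -/
theorem IsEDCS.gap_le_gap {V : Type*} {G A B : SimpleGraph V} {β βm : ℝ}
    (hA : IsEDCS G A β βm) (hB : IsEDCS G B β βm) {v u : V} (h₁ : A.Adj v u)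
    (h₂ : ¬ B.Adj v u) :
    (deg A v : ℝ) - deg B v - (β - βm) ≤ (deg B u : ℝ) - deg A u := by
  have := hA.2.1 v u h₁
  have := hB.2.2 v u (hA.1 h₁) h₂
  linarith

/-- Let `A, B` be two `EDCS(G, β, (1-λ)β)` with `0 < λ < 1/100`, let `D > 2·√λ·β`, and let
`S ⊆ V` satisfy `deg_A(v) - deg_B(v) ≥ D` for all `v ∈ S`.  Then there is a set `S' ⊇ S`
with `|S'| ≥ (1 + 2√λ)·|S|` such that `deg_A(v) - deg_B(v) ≥ D - 2λβ` for all `v ∈ S'`. -/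
theorem edcs_gap_set_grows {V : Type*} [Fintype V] (G A B : SimpleGraph V)
    (lam β D : ℝ) (hlam0 : 0 < lam) (hlam1 : lam < 1 / 100) (hβ : 0 < β)
    (hA : IsEDCS G A β ((1 - lam) * β)) (hB : IsEDCS G B β ((1 - lam) * β))
    (hD : 2 * Real.sqrt lam * β < D) (S : Set V)
    (hS : ∀ v ∈ S, D ≤ (deg A v : ℝ) - (deg B v : ℝ)) :
    ∃ S' : Set V, S ⊆ S' ∧ (1 + 2 * Real.sqrt lam) * (S.ncard : ℝ) ≤ (S'.ncard : ℝ) ∧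
      ∀ v ∈ S', D - 2 * lam * β ≤ (deg A v : ℝ) - (deg B v : ℝ) := by
  classical
  let S' : Finset V := {v | D - 2 * lam * β ≤ (deg A v : ℝ) - (deg B v : ℝ)}
  let T : Finset V := {v | D - lam * β ≤ (deg B v : ℝ) - (deg A v : ℝ)}
  have hlamβ : 0 < lam * β := mul_pos hlam0 hβ
  have hsub : S.toFinset ⊆ S' := fun v hv => by
    have := hS v (Set.mem_toFinset.1 hv)
    simp only [S', Finset.mem_filter, Finset.mem_univ, true_and]
    linarith
  have hlam_le : lam ≤ Real.sqrt lam := Real.le_sqrt_of_sq_le (by nlinarith)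
  have hgap : 0 ≤ D - lam * β := by
    have := mul_le_mul_of_nonneg_right hlam_le hβ.le
    linarith
  have hST : ∑ v ∈ S.toFinset, degDiff A B v ≤ ∑ u ∈ T, degDiff A B u := by
    refine sum_degDiff_le_sum_degDiff A B _ _ fun v hv u h₁ h₂ => ?_
    have := hS v (Set.mem_toFinset.1 hv)
    have := hA.gap_le_gap hB h₁ h₂
    simp only [T, Finset.mem_filter, Finset.mem_univ, true_and]
    linarith
  have hT : ∑ u ∈ T, degDiff A B u ≤ ∑ u ∈ T, degDiff B A u := by
    refine Finset.sum_le_sum fun u hu => ?_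
    have := degDiff_sub_degDiff B A u
    simp only [T, Finset.mem_filter, Finset.mem_univ, true_and] at hu
    linarith
  have hTS' : ∑ u ∈ T, degDiff B A u ≤ ∑ w ∈ S', degDiff B A w := by
    refine sum_degDiff_le_sum_degDiff B A _ _ fun v hv u h₁ h₂ => ?_
    have := hB.gap_le_gap hA h₁ h₂
    simp only [S', T, Finset.mem_filter, Finset.mem_univ, true_and] at hv ⊢
    linarith
  have hsplit := Finset.sum_sdiff hsub (f := degDiff B A)
  have hnew : ∑ w ∈ S' \ S.toFinset, degDiff B A w ≤ (S' \ S.toFinset).card * β := by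
    rw [← nsmul_eq_mul]
    exact Finset.sum_le_card_nsmul _ _ _ fun w _ =>
      (degDiff_le_deg B A w).trans (hB.deg_le hβ.le w)
  have hold : S.toFinset.card * D ≤
      ∑ v ∈ S.toFinset, degDiff A B v - ∑ v ∈ S.toFinset, degDiff B A v := by
    rw [← nsmul_eq_mul, ← Finset.sum_sub_distrib]
    refine Finset.card_nsmul_le_sum _ _ _ fun v hv => ?_
    rw [degDiff_sub_degDiff]
    exact hS v (Set.mem_toFinset.1 hv)
  have hcard : ((S' \ S.toFinset).card : ℝ) + S.toFinset.card = S'.card := by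
    exact_mod_cast Finset.card_sdiff_add_card_eq_card hsub
  refine ⟨S', fun v hv => hsub (Set.mem_toFinset.2 hv), ?_, fun v hv => ?_⟩
  · rw [Set.ncard_coe_finset, Set.ncard_eq_toFinset_card', ← hcard]
    have hSD : (S.toFinset.card : ℝ) * (2 * Real.sqrt lam * β) ≤ S.toFinset.card * D :=
      mul_le_mul_of_nonneg_left hD.le (Nat.cast_nonneg _)
    have : 2 * Real.sqrt lam * S.toFinset.card ≤ ((S' \ S.toFinset).card : ℝ) := by
      refine le_of_mul_le_mul_right ?_ hβ
      linarith
    linarith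
  · simpa [S'] using hv
end

section
/- Let G = (V,E) be a graph, p ∈ (0,1), and let G^E_p be the edge sampled subgraph of G with probability p. Let μ > 0 be a real with E[MM(G^E_p)] ≤ μ. Then for any λ > 0, Pr( |MM(G^E_p) − E[MM(G^E_p)]| ≥ λ ) ≤ 2·exp( − λ²·p / (2μ) ). -/
/-- `M` is a matching of the graph `G`: a set of pairwise vertex-disjoint edges of `G`. -/
def IsMatching {V : Type*} (G : SimpleGraph V) (M : Set (Sym2 V)) : Prop :=
  M ⊆ G.edgeSet ∧ M.Pairwise fun e f => ∀ v : V, v ∈ e → v ∉ f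

/-- `MM G` is the maximum cardinality of a matching in `G`. -/
noncomputable def MM {V : Type*} (G : SimpleGraph V) : ℕ :=
  sSup {n : ℕ | ∃ M : Set (Sym2 V), IsMatching G M ∧ n = M.ncard}

/-- The probability weight of the outcome `ω` when each potential edge is kept
independently with probability `p`. -/
noncomputable def pw {V : Type*} [Fintype V] [DecidableEq V] (p : ℝ)
    (ω : Sym2 V → Bool) : ℝ :=
  ∏ e : Sym2 V, (if ω e then p else 1 - p)

/-- The edge sampled subgraph of `G` determined by the outcome `ω`: it keeps exactly the
edges `e` of `G` with `ω e = true`. -/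
def esub {V : Type*} (G : SimpleGraph V) (ω : Sym2 V → Bool) : SimpleGraph V :=
  G ⊓ SimpleGraph.fromEdgeSet {e | ω e = true}

/-- Expectation of `f` under the edge-sampling distribution with probability `p`. -/
noncomputable def EE {V : Type*} [Fintype V] [DecidableEq V] (p : ℝ)
    (f : (Sym2 V → Bool) → ℝ) : ℝ :=
  ∑ ω : Sym2 V → Bool, pw p ω * f ω

/-- Probability of the event `A` under the edge-sampling distribution with probability `p`. -/
noncomputable def PrE {V : Type*} [Fintype V] [DecidableEq V] (p : ℝ)
    (A : Set (Sym2 V → Bool)) : ℝ :=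
  ∑ ω : Sym2 V → Bool, A.indicator (pw p) ω

open Finset

/-- Hoeffding's lemma for a finitely supported distribution with weights `w`. -/
lemma sum_mul_exp_le_of_mem_Icc {Ω : Type*} [Fintype Ω] (w X : Ω → ℝ) (hw : ∀ i, 0 ≤ w i)
    (hw1 : ∑ i, w i = 1) (a : ℝ) (hX : ∀ i, X i ∈ Set.Icc a (a + 1)) (s : ℝ) :
    ∑ i, w i * Real.exp (s * X i) ≤ Real.exp (s ^ 2 / 8 + s * ∑ i, w i * X i) := by
  let _ : MeasurableSpace Ω := ⊤
  have _ : MeasurableSingletonClass Ω := ⟨fun _ => trivial⟩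
  let P : PMF Ω := PMF.ofFintype (fun i => ENNReal.ofReal (w i)) (by
    rw [← ENNReal.ofReal_sum_of_nonneg fun i _ => hw i, hw1, ENNReal.ofReal_one])
  have integral_eq (f : Ω → ℝ) : ∫ i, f i ∂P.toMeasure = ∑ i, w i * f i := by
    rw [PMF.integral_eq_sum]
    simp [P, ENNReal.toReal_ofReal (hw _)]
  have hsub := (ProbabilityTheory.hasSubgaussianMGF_of_mem_Icc (μ := P.toMeasure) (X := X)
    (a := a) (b := a + 1) (measurable_of_finite X).aemeasurable
    (Filter.Eventually.of_forall hX)).mgf_le s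
  rw [ProbabilityTheory.mgf, integral_eq, integral_eq] at hsub
  calc ∑ i, w i * Real.exp (s * X i)
      = (∑ i, w i * Real.exp (s * (X i - ∑ j, w j * X j))) *
          Real.exp (s * ∑ j, w j * X j) := by
        rw [Finset.sum_mul]
        refine Finset.sum_congr rfl fun i _ => ?_
        rw [mul_assoc, ← Real.exp_add]
        ring_nf
    _ ≤ _ := by
        rw [Real.exp_add]
        refine mul_le_mul_of_nonneg_right (hsub.trans (le_of_eq ?_)) (Real.exp_nonneg _)
        congr 1
        norm_num
        ring

/-- Changing the coordinates in `S` changes `f` by at most one. -/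
def BoundedDiffOn {V : Type*} (f : (Sym2 V → Bool) → ℝ) (S : Set (Sym2 V)) : Prop :=
  ∀ ω ω', (∀ e ∉ S, ω e = ω' e) → f ω ≤ f ω' + 1

lemma BoundedDiffOn.neg {V : Type*} {f : (Sym2 V → Bool) → ℝ} {S : Set (Sym2 V)}
    (h : BoundedDiffOn f S) :
    BoundedDiffOn (fun ω => -f ω) S := fun ω ω' hω => by
  linarith [h ω' ω fun e he => (hω e he).symm]

section Sampling

variable {V : Type*} [Fintype V] [DecidableEq V] {p : ℝ}

lemma pw_nonneg (hp0 : 0 ≤ p) (hp1 : p ≤ 1) (ω : Sym2 V → Bool) : 0 ≤ pw p ω :=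
  Finset.prod_nonneg fun e _ => by split_ifs <;> linarith

lemma sum_prod_bool (g : Sym2 V → Bool → ℝ) :
    ∑ ω : Sym2 V → Bool, ∏ e, g e (ω e) = ∏ e, (g e true + g e false) := by
  rw [← Fintype.piFinset_univ, ← Finset.prod_univ_sum]
  simp

lemma sum_pw (p : ℝ) : ∑ ω : Sym2 V → Bool, pw p ω = 1 := by
  have h := sum_prod_bool (V := V) fun _ b => if b then p else 1 - p
  simpa [pw] using h

lemma EE_mono (hp0 : 0 ≤ p) (hp1 : p ≤ 1) {f g : (Sym2 V → Bool) → ℝ} (h : ∀ ω, f ω ≤ g ω) :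
    EE p f ≤ EE p g :=
  Finset.sum_le_sum fun ω _ => mul_le_mul_of_nonneg_left (h ω) (pw_nonneg hp0 hp1 ω)

lemma EE_const (p c : ℝ) : EE p (fun _ : Sym2 V → Bool => c) = c := by
  rw [EE, ← Finset.sum_mul, sum_pw, one_mul]

lemma EE_const_mul (p c : ℝ) (f : (Sym2 V → Bool) → ℝ) :
    EE p (fun ω => c * f ω) = c * EE p f := by
  simp only [EE, Finset.mul_sum]
  exact Finset.sum_congr rfl fun _ _ => by ring

/-- Each edge is kept with probability `p`. -/
lemma EE_indicator_edge (p : ℝ) (e : Sym2 V) :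
    EE p (fun ω => if ω e then 1 else 0) = p := by
  have h := sum_prod_bool fun e' b =>
    if e' = e then (if b then p else 0) else (if b then p else 1 - p)
  have hr : ∏ e' : Sym2 V, ((if e' = e then (if true = true then p else 0)
      else (if true = true then p else 1 - p)) + (if e' = e then (if false = true then p else 0)
      else (if false = true then p else 1 - p))) = p := by
    rw [Finset.prod_eq_single e]
    · simp
    · intro b _ hb
      simp [hb]
    · simp
  refine Eq.trans ?_ (h.trans hr)
  refine Finset.sum_congr rfl fun ω _ => ?_
  by_cases he : ω e = true
  · simp only [he, if_true, mul_one, pw]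
    refine Finset.prod_congr rfl fun e' _ => ?_
    by_cases h' : e' = e
    · simp [h', he]
    · simp [h']
  · simp only [he]
    rw [Finset.prod_eq_zero (Finset.mem_univ e)] <;> simp [he]

open Classical in
/-- The conditional expectation of `f` given the coordinates outside `S`. -/
noncomputable def resample (p : ℝ) (S : Set (Sym2 V)) (f : (Sym2 V → Bool) → ℝ)
    (ω : Sym2 V → Bool) : ℝ :=
  EE p fun η => f (S.piecewise η ω)

open Classical in
lemma EE_resample (p : ℝ) (S : Set (Sym2 V)) (f : (Sym2 V → Bool) → ℝ) :
    EE p (resample p S f) = EE p f := by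
  have hpw (ω η : Sym2 V → Bool) :
      pw p (S.piecewise η ω) * pw p (S.piecewise ω η) = pw p ω * pw p η := by
    simp only [pw, ← Finset.prod_mul_distrib]
    refine Finset.prod_congr rfl fun e _ => ?_
    by_cases he : e ∈ S
    · simp [he, mul_comm]
    · simp [he]
  let swap : (Sym2 V → Bool) × (Sym2 V → Bool) → (Sym2 V → Bool) × (Sym2 V → Bool) :=
    fun x => (S.piecewise x.2 x.1, S.piecewise x.1 x.2)
  have hswap : Function.Involutive swap := by
    rintro ⟨ω, η⟩
    refine Prod.ext ?_ ?_ <;> funext e <;> by_cases he : e ∈ S <;> simp [swap, he]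
  calc EE p (resample p S f)
      = ∑ x : (Sym2 V → Bool) × (Sym2 V → Bool),
          pw p (swap x).1 * pw p (swap x).2 * f (swap x).1 := by
        simp only [EE, resample, Finset.mul_sum, Fintype.sum_prod_type, swap, hpw, mul_assoc]
    _ = ∑ x : (Sym2 V → Bool) × (Sym2 V → Bool), pw p x.1 * pw p x.2 * f x.1 :=
        Equiv.sum_comp hswap.toPerm
          (fun x : (Sym2 V → Bool) × (Sym2 V → Bool) => pw p x.1 * pw p x.2 * f x.1)
    _ = EE p f := by
        rw [Fintype.sum_prod_type, EE]
        refine Finset.sum_congr rfl fun ω _ => ?_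
        simp only [mul_right_comm (pw p ω) _ (f ω)]
        rw [← Finset.mul_sum, sum_pw, mul_one]

lemma BoundedDiffOn.resample (hp0 : 0 ≤ p) (hp1 : p ≤ 1) {f : (Sym2 V → Bool) → ℝ}
    {T : Set (Sym2 V)} (h : BoundedDiffOn f T) (S : Set (Sym2 V)) :
    BoundedDiffOn (resample p S f) T := by
  classical
  intro ω ω' hω
  have hsplit (η : Sym2 V → Bool) : f (S.piecewise η ω) ≤ f (S.piecewise η ω') + 1 := by
    refine h _ _ fun e he => ?_
    by_cases heS : e ∈ S <;> simp [heS, hω e he]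
  calc _root_.resample p S f ω ≤ EE p (fun η => f (S.piecewise η ω') + 1) :=
        EE_mono hp0 hp1 hsplit
    _ = _root_.resample p S f ω' + 1 := by
        simp only [EE, _root_.resample, mul_add, Finset.sum_add_distrib, mul_one, sum_pw]

lemma dependsOn_resample {f : (Sym2 V → Bool) → ℝ} {S T : Set (Sym2 V)}
    (h : DependsOn f (S ∪ T)) : DependsOn (resample p S f) T := by
  classical
  intro ω ω' hω
  simp only [resample]
  congr 1
  funext η
  refine h fun e he => ?_
  by_cases heS : e ∈ S
  · simp [heS]
  · simp [heS, hω e (he.resolve_left heS)]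

lemma resample_exp_le (hp0 : 0 ≤ p) (hp1 : p ≤ 1) {f : (Sym2 V → Bool) → ℝ}
    {S : Set (Sym2 V)} (h : BoundedDiffOn f S) (s : ℝ) (ω : Sym2 V → Bool) :
    resample p S (fun ω => Real.exp (s * f ω)) ω ≤
      Real.exp (s ^ 2 / 8) * Real.exp (s * resample p S f ω) := by
  classical
  obtain ⟨η₀, hη₀⟩ := Finite.exists_min fun η => f (S.piecewise η ω)
  rw [← Real.exp_add]
  refine sum_mul_exp_le_of_mem_Icc (pw p) (fun η => f (S.piecewise η ω))
    (pw_nonneg hp0 hp1) (sum_pw p) (f (S.piecewise η₀ ω)) (fun η => ⟨hη₀ η, ?_⟩) s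
  exact h _ _ fun e he => by simp [he]

/-- Exponential moment form of McDiarmid's inequality for blocks of coordinates. -/
lemma EE_exp_le_of_boundedDiffOn {κ : Type*} (hp0 : 0 ≤ p) (hp1 : p ≤ 1) (S : κ → Set (Sym2 V))
    (s : ℝ) (C : Finset κ) (f : (Sym2 V → Bool) → ℝ) (hdep : DependsOn f (⋃ k ∈ C, S k))
    (hdiff : ∀ k ∈ C, BoundedDiffOn f (S k)) :
    EE p (fun ω => Real.exp (s * f ω)) ≤ Real.exp (#C * s ^ 2 / 8 + s * EE p f) := by
  classical
  induction C using Finset.induction_on generalizing f with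
  | empty =>
    have hf : f = fun _ => f fun _ => true := by
      funext ω
      exact hdep (by simp)
    rw [hf, EE_const, EE_const]
    simp
  | insert k C hk ih =>
    rw [Finset.set_biUnion_insert] at hdep
    have hrec := ih (resample p (S k) f) (dependsOn_resample hdep) fun j hj =>
      (hdiff j (Finset.mem_insert_of_mem hj)).resample hp0 hp1 _
    rw [EE_resample] at hrec
    rw [← EE_resample p (S k)]
    refine (EE_mono hp0 hp1
      (resample_exp_le hp0 hp1 (hdiff k (Finset.mem_insert_self k C)) s)).trans ?_
    rw [EE_const_mul]
    refine (mul_le_mul_of_nonneg_left hrec (Real.exp_nonneg _)).trans (le_of_eq ?_)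
    rw [← Real.exp_add, Finset.card_insert_of_notMem hk]
    push_cast
    ring_nf

/-- McDiarmid's inequality (upper tail) for blocks of coordinates. -/
lemma PrE_ge_le_of_boundedDiffOn {κ : Type*} (hp0 : 0 ≤ p) (hp1 : p ≤ 1)
    (S : κ → Set (Sym2 V)) (C : Finset κ) (f : (Sym2 V → Bool) → ℝ)
    (hdep : DependsOn f (⋃ k ∈ C, S k)) (hdiff : ∀ k ∈ C, BoundedDiffOn f (S k))
    (lam c : ℝ) (hlam : 0 ≤ lam) (hc : 0 < c) (hC : (#C : ℝ) ≤ 2 * c) :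
    PrE p {ω | lam ≤ f ω - EE p f} ≤ Real.exp (-lam ^ 2 / c) := by
  set s := 2 * lam / c with hs
  have hs0 : 0 ≤ s := by positivity
  calc PrE p {ω | lam ≤ f ω - EE p f}
      ≤ EE p (fun ω => Real.exp (-s * (lam + EE p f)) * Real.exp (s * f ω)) := by
        refine Finset.sum_le_sum fun ω _ => ?_
        refine Set.indicator_apply_le' (fun hω => ?_) fun _ =>
          mul_nonneg (pw_nonneg hp0 hp1 ω) (by positivity)
        refine le_mul_of_one_le_right (pw_nonneg hp0 hp1 ω) ?_
        simp only [← Real.exp_add, Real.one_le_exp_iff]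
        have hω' : lam ≤ f ω - EE p f := hω
        nlinarith
    _ ≤ Real.exp (-s * (lam + EE p f)) * Real.exp (#C * s ^ 2 / 8 + s * EE p f) := by
        rw [EE_const_mul]
        exact mul_le_mul_of_nonneg_left (EE_exp_le_of_boundedDiffOn hp0 hp1 S s C f hdep hdiff)
          (Real.exp_nonneg _)
    _ = Real.exp (-s * lam + #C * s ^ 2 / 8) := by
        rw [← Real.exp_add]
        ring_nf
    _ ≤ Real.exp (-s * lam + 2 * c * s ^ 2 / 8) := by gcongr
    _ = Real.exp (-lam ^ 2 / c) := by
        congr 1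
        rw [hs]
        field_simp
        ring

lemma PrE_abs_ge_le_of_boundedDiffOn {κ : Type*} (hp0 : 0 ≤ p) (hp1 : p ≤ 1)
    (S : κ → Set (Sym2 V)) (C : Finset κ) (f : (Sym2 V → Bool) → ℝ)
    (hdep : DependsOn f (⋃ k ∈ C, S k)) (hdiff : ∀ k ∈ C, BoundedDiffOn f (S k))
    (lam c : ℝ) (hlam : 0 ≤ lam) (hc : 0 < c) (hC : (#C : ℝ) ≤ 2 * c) :
    PrE p {ω | lam ≤ |f ω - EE p f|} ≤ 2 * Real.exp (-lam ^ 2 / c) := by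
  have hneg : EE p (fun ω => -f ω) = -EE p f := by
    simpa using EE_const_mul p (-1) f
  have hupper := PrE_ge_le_of_boundedDiffOn hp0 hp1 S C f hdep hdiff lam c hlam hc hC
  have hlower := PrE_ge_le_of_boundedDiffOn hp0 hp1 S C (fun ω => -f ω)
    (fun _ _ h => congrArg Neg.neg (hdep h)) (fun k hk => (hdiff k hk).neg) lam c hlam hc hC
  rw [hneg] at hlower
  have hunion : PrE p {ω | lam ≤ |f ω - EE p f|} ≤
      PrE p {ω | lam ≤ f ω - EE p f} + PrE p {ω | lam ≤ -f ω - -EE p f} := by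
    simp only [PrE, ← Finset.sum_add_distrib]
    refine Finset.sum_le_sum fun ω _ => ?_
    have hpos' (A : Set (Sym2 V → Bool)) : 0 ≤ A.indicator (pw p) ω :=
      Set.indicator_nonneg (fun ω _ => pw_nonneg hp0 hp1 ω) ω
    refine Set.indicator_apply_le' (fun hω => ?_) fun _ => add_nonneg (hpos' _) (hpos' _)
    rcases le_abs.mp (show lam ≤ |f ω - EE p f| from hω) with h | h
    · rw [Set.indicator_of_mem (show ω ∈ {ω | lam ≤ f ω - EE p f} from h)]
      linarith [hpos' {ω | lam ≤ -f ω - -EE p f}]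
    · rw [Set.indicator_of_mem (show ω ∈ {ω | lam ≤ -f ω - -EE p f} by
        simp only [Set.mem_ofPred_eq]; linarith)]
      linarith [hpos' {ω | lam ≤ f ω - EE p f}]
  linarith

end Sampling

section Matching

variable {V : Type*} [Fintype V]

lemma bddAbove_ncard_matching (G : SimpleGraph V) :
    BddAbove {n : ℕ | ∃ M : Set (Sym2 V), IsMatching G M ∧ n = M.ncard} := by
  classical
  refine ⟨Fintype.card (Sym2 V), ?_⟩
  rintro _ ⟨M, -, rfl⟩
  rw [← Nat.card_eq_fintype_card]
  exact Set.ncard_le_card M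

lemma IsMatching.ncard_le_MM {G : SimpleGraph V} {M : Set (Sym2 V)} (h : IsMatching G M) :
    M.ncard ≤ MM G :=
  le_csSup (bddAbove_ncard_matching G) ⟨M, h, rfl⟩

lemma exists_isMatching_ncard_eq_MM (G : SimpleGraph V) :
    ∃ M : Set (Sym2 V), IsMatching G M ∧ M.ncard = MM G := by
  obtain ⟨M, hM, h⟩ := Nat.sSup_mem (s := {n : ℕ | ∃ M : Set (Sym2 V), IsMatching G M ∧
    n = M.ncard}) ⟨_, ∅, ⟨Set.empty_subset _, Set.pairwise_empty _⟩, rfl⟩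
    (bddAbove_ncard_matching G)
  exact ⟨M, hM, h.symm⟩

lemma mem_edgeSet_esub {V : Type*} {G : SimpleGraph V} {ω : Sym2 V → Bool} {e : Sym2 V} :
    e ∈ (esub G ω).edgeSet ↔ e ∈ G.edgeSet ∧ ω e = true := by
  induction e with
  | _ a b =>
    simp only [esub, SimpleGraph.mem_edgeSet, SimpleGraph.inf_adj, SimpleGraph.fromEdgeSet_adj,
      Set.mem_ofPred_eq]
    exact ⟨fun h => ⟨h.1, h.2.1⟩, fun h => ⟨h.1, h.2, h.1.ne⟩⟩

/-- Changing the edges at a single vertex changes the matching number by at most one. -/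
lemma MM_esub_le_add_one (G : SimpleGraph V) (v : V) (ω ω' : Sym2 V → Bool)
    (h : ∀ e : Sym2 V, v ∉ e → ω e = ω' e) : MM (esub G ω) ≤ MM (esub G ω') + 1 := by
  obtain ⟨M, ⟨hsub, hdisj⟩, hM⟩ := exists_isMatching_ncard_eq_MM (esub G ω)
  have hM' : IsMatching (esub G ω') (M \ {e | v ∈ e}) := by
    refine ⟨fun e he => ?_, hdisj.mono Set.sdiff_subset⟩
    have he' := mem_edgeSet_esub.mp (hsub he.1)
    exact mem_edgeSet_esub.mpr ⟨he'.1, h e he.2 ▸ he'.2⟩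
  have hone : (M ∩ {e | v ∈ e}).ncard ≤ 1 := by
    rw [Set.ncard_le_one]
    intro e he f hf
    by_contra hne
    exact hdisj he.1 hf.1 hne v he.2 hf.2
  have hsum := Set.ncard_inter_add_ncard_sdiff_eq_ncard M {e : Sym2 V | v ∈ e}
  have := hM'.ncard_le_MM
  omega

/-- The endpoints of a maximum matching form a vertex cover. -/
lemma exists_vertexCover_card_le (G : SimpleGraph V) :
    ∃ C : Finset V, #C ≤ 2 * MM G ∧ ∀ e ∈ G.edgeSet, ∃ v ∈ C, v ∈ e := by
  classical
  obtain ⟨M, ⟨hsub, hdisj⟩, hM⟩ := exists_isMatching_ncard_eq_MM G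
  refine ⟨M.toFinset.biUnion Sym2.toFinset, ?_, fun e he => ?_⟩
  · rw [← hM, Set.ncard_eq_toFinset_card', mul_comm]
    refine Finset.card_biUnion_le_card_mul _ _ _ fun e _ => ?_
    rw [Sym2.card_toFinset]
    split_ifs <;> norm_num
  · by_contra! hcon
    have hdis (f : Sym2 V) (hf : f ∈ M) (v : V) (hv : v ∈ f) : v ∉ e :=
      hcon v (by simpa using ⟨f, hf, hv⟩)
    have heM : e ∉ M := fun hmem =>
      hdis e hmem _ (Sym2.out_fst_mem e) (Sym2.out_fst_mem e)
    have hins : IsMatching G (insert e M) := by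
      refine ⟨Set.insert_subset he hsub, hdisj.insert fun f hf _ => ⟨?_, ?_⟩⟩
      · exact fun v hve hvf => hdis f hf v hvf hve
      · exact hdis f hf
    have := hins.ncard_le_MM
    rw [Set.ncard_insert_of_notMem heM] at this
    omega

/-- A maximum matching retains a `p` fraction of its edges in expectation. -/
lemma mul_MM_le_EE_MM_esub [DecidableEq V] (G : SimpleGraph V) {p : ℝ} (hp0 : 0 ≤ p)
    (hp1 : p ≤ 1) : p * MM G ≤ EE p (fun ω => (MM (esub G ω) : ℝ)) := by
  classical
  obtain ⟨M, ⟨hsub, hdisj⟩, hM⟩ := exists_isMatching_ncard_eq_MM G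
  have hle (ω : Sym2 V → Bool) :
      ∑ e ∈ M.toFinset, (if ω e then (1 : ℝ) else 0) ≤ MM (esub G ω) := by
    have hmatch : IsMatching (esub G ω) (M ∩ {e | ω e = true}) :=
      ⟨fun e he => mem_edgeSet_esub.mpr ⟨hsub he.1, he.2⟩, hdisj.mono Set.inter_subset_left⟩
    rw [Finset.sum_boole]
    refine Nat.cast_le.mpr (le_trans (le_of_eq ?_) hmatch.ncard_le_MM)
    rw [← Set.ncard_coe_finset]
    congr 1
    ext e
    simp
  refine le_trans (le_of_eq ?_) (EE_mono hp0 hp1 hle)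
  have hlin : EE p (fun ω => ∑ e ∈ M.toFinset, (if ω e then (1 : ℝ) else 0)) =
      ∑ e ∈ M.toFinset, EE p (fun ω => if ω e then (1 : ℝ) else 0) := by
    simp only [EE, Finset.mul_sum]
    exact Finset.sum_comm
  rw [hlin, Finset.sum_congr rfl fun e _ => EE_indicator_edge p e, Finset.sum_const,
    nsmul_eq_mul, ← hM, Set.ncard_eq_toFinset_card', mul_comm]

end Matching

/-- Concentration of the maximum matching size under edge sampling: for `p ∈ (0,1)` and
`μ ≥ E[MM(G^E_p)]`, `Pr(|MM(G^E_p) - E[MM(G^E_p)]| ≥ λ) ≤ 2·exp(-λ²·p/(2μ))`. -/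
theorem sampled_matching_concentration {V : Type*} [Fintype V] [DecidableEq V]
    (G : SimpleGraph V) (p : ℝ) (hp0 : 0 < p) (hp1 : p < 1) (μ : ℝ) (hμ : 0 < μ)
    (hEx : EE p (fun ω => (MM (esub G ω) : ℝ)) ≤ μ) (lam : ℝ) (hlam : 0 < lam) :
    PrE p {ω : Sym2 V → Bool |
        lam ≤ |(MM (esub G ω) : ℝ) - EE p (fun ω' => (MM (esub G ω') : ℝ))|} ≤
      2 * Real.exp (-(lam ^ 2 * p) / (2 * μ)) := by
  obtain ⟨C, hcard, hcover⟩ := exists_vertexCover_card_le G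
  have hdep : DependsOn (fun ω => (MM (esub G ω) : ℝ)) (⋃ v ∈ C, {e : Sym2 V | v ∈ e}) := by
    intro ω ω' h
    have hgraph : esub G ω = esub G ω' := by
      refine SimpleGraph.edgeSet_injective (Set.ext fun e => ?_)
      rw [mem_edgeSet_esub, mem_edgeSet_esub]
      refine and_congr_right fun he => ?_
      rw [h e (by simpa using hcover e he)]
    simp only [hgraph]
  have hdiff : ∀ v ∈ C, BoundedDiffOn (fun ω => (MM (esub G ω) : ℝ)) {e : Sym2 V | v ∈ e} :=
    fun v _ ω ω' h => by
      beta_reduce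
      exact_mod_cast MM_esub_le_add_one G v ω ω' h
  have hMM : (MM G : ℝ) ≤ μ / p := by
    rw [le_div_iff₀ hp0, mul_comm]
    exact (mul_MM_le_EE_MM_esub G hp0.le hp1.le).trans hEx
  have hC : (#C : ℝ) ≤ 2 * (μ / p) := by
    have : (#C : ℝ) ≤ 2 * MM G := by exact_mod_cast hcard
    linarith
  refine (PrE_abs_ge_le_of_boundedDiffOn hp0.le hp1.le _ C _ hdep hdiff lam (μ / p) hlam.le
    (by positivity) hC).trans ?_
  gcongr 2 * Real.exp ?_
  have hnonneg : 0 ≤ lam ^ 2 * p / (2 * μ) := by positivity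
  have hrate : -lam ^ 2 / (μ / p) = 2 * (-(lam ^ 2 * p) / (2 * μ)) := by
    field_simp
  rw [hrate, neg_div]
  linarith
end
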